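/- arXiv:2201.07577 — 7 statements merged into one kernel-verified Lean document; each statement's English description precedes it below -/
import Mathlib

section
/- Let i be a node with nonempty finite neighbour set N, weights w : N → ℝ with w j > 0 for all j ∈ N, slowness s > 0, value u_i ∈ ℝ and neighbour values u : N → ℝ, and let K = {j ∈ N : u j < u_i}. Then the following are equivalent: (a) K is nonempty and u_i = min_{j ∈ K} (u j + s / w j); (b) max_{j ∈ N} w j · (u_i − u j)⁺ = s. (Equivalence of the front propagation Model 1(i) update formula and the ℓ∞ graph-eikonal equation at node i.) -/
theorem Finset.sup'_eq_iff_isGreatest {ι α : Type*} [LinearOrder α] {t : Finset ι}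
    (ht : t.Nonempty) (f : ι → α) (a : α) :
    t.sup' ht f = a ↔ (∀ j ∈ t, f j ≤ a) ∧ ∃ j ∈ t, f j = a := by
  constructor
  · rintro rfl
    obtain ⟨j, hj, h⟩ := t.exists_mem_eq_sup' ht f
    exact ⟨fun j hj => t.le_sup' f hj, j, hj, h.symm⟩
  · rintro ⟨hle, j, hj, rfl⟩
    exact le_antisymm (t.sup'_le ht f hle) (t.le_sup' f hj)

theorem Finset.inf'_eq_iff_isLeast {ι α : Type*} [LinearOrder α] {t : Finset ι}
    (ht : t.Nonempty) (f : ι → α) (a : α) :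
    t.inf' ht f = a ↔ (∀ j ∈ t, a ≤ f j) ∧ ∃ j ∈ t, f j = a :=
  Finset.sup'_eq_iff_isGreatest (α := αᵒᵈ) ht f a

theorem mul_posPart_sub_le_iff {w s : ℝ} (hw : 0 < w) (hs : 0 < s) (a b : ℝ) :
    w * max (a - b) 0 ≤ s ↔ (b < a → a ≤ b + s / w) := by
  rw [← le_div_iff₀' hw, max_le_iff, sub_le_iff_le_add']
  have h : 0 < s / w := div_pos hs hw
  refine ⟨fun H _ => H.1, fun H => ⟨?_, h.le⟩⟩
  rcases lt_or_ge b a with hab | hab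
  · exact H hab
  · linarith

theorem mul_posPart_sub_eq_iff {w s : ℝ} (hw : 0 < w) (hs : 0 < s) (a b : ℝ) :
    w * max (a - b) 0 = s ↔ b < a ∧ b + s / w = a := by
  rw [mul_comm, ← eq_div_iff hw.ne']
  have h : 0 < s / w := div_pos hs hw
  rcases lt_or_ge b a with hab | hab
  · rw [max_eq_left (sub_nonneg.2 hab.le), sub_eq_iff_eq_add', eq_comm]
    simp [hab]
  · rw [max_eq_right (sub_nonpos.2 hab)]
    exact ⟨fun H => absurd H h.ne, fun H => absurd H.1 hab.not_gt⟩

/-- Equivalence of the front propagation Model 1(i) update formula and the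
ℓ∞ graph-eikonal equation at node i. -/
theorem stmt0 {ι : Type*} [Fintype ι] [Nonempty ι]
    (w u : ι → ℝ) (ui s : ℝ) (hw : ∀ j, 0 < w j) (hs : 0 < s) :
    (∃ hK : (Finset.univ.filter fun j => u j < ui).Nonempty,
        ui = (Finset.univ.filter fun j => u j < ui).inf' hK (fun j => u j + s / w j)) ↔
      Finset.univ.sup' Finset.univ_nonempty (fun j => w j * max (ui - u j) 0) = s := by
  simp only [eq_comm (a := ui), Finset.inf'_eq_iff_isLeast, Finset.sup'_eq_iff_isGreatest,
    Finset.mem_filter, Finset.mem_univ, true_and, forall_const,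
    mul_posPart_sub_le_iff (hw _) hs, mul_posPart_sub_eq_iff (hw _) hs]
  refine ⟨fun ⟨_, h⟩ => h, fun h => ⟨?_, h⟩⟩
  obtain ⟨j, hj, -⟩ := h.2
  exact ⟨j, by simpa using hj⟩
end

section
/- Let i be a node with nonempty finite neighbour set N, weights w : N → ℝ with w j > 0 for all j ∈ N, slowness s > 0, value u_i ∈ ℝ and neighbour values u : N → ℝ, and let K = {j ∈ N : u j < u_i}. Set z = ∑_{j ∈ K} (w j)², μ = (1/z) ∑_{j ∈ K} (w j)² · u j and σ² = (1/z) ∑_{j ∈ K} (w j)² · (u j)² − μ². Then the following are equivalent: (a) K is nonempty, σ² ≤ s²/z, and u_i = μ + √(s²/z − σ²); (b) ∑_{j ∈ N} (w j)² · ((u_i − u j)⁺)² = s². (Equivalence of the front propagation Model 1(ii) update formula and the ℓ² graph-eikonal equation at node i.) -/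
/-- A sum of squared positive parts only sees the indices where the argument is positive. -/
theorem sum_mul_sq_max_sub_zero {ι : Type*} [Fintype ι] (c u : ι → ℝ) (a : ℝ) :
    ∑ j, c j * (max (a - u j) 0) ^ 2 =
      ∑ j ∈ Finset.univ.filter (fun j => u j < a), c j * (a - u j) ^ 2 := by
  rw [Finset.sum_filter]
  refine Finset.sum_congr rfl fun j _ => ?_
  split_ifs with h
  · rw [max_eq_left (sub_nonneg.2 h.le)]
  · rw [max_eq_right (sub_nonpos.2 (not_lt.1 h))]
    simp

/-- Expansion of a weighted sum of squared distances in terms of the weighted moments. -/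
theorem sum_mul_sub_sq {ι : Type*} (K : Finset ι) (c u : ι → ℝ) (a : ℝ) :
    ∑ j ∈ K, c j * (a - u j) ^ 2 =
      (∑ j ∈ K, c j) * a ^ 2 - 2 * a * ∑ j ∈ K, c j * u j + ∑ j ∈ K, c j * u j ^ 2 := by
  rw [Finset.sum_mul, Finset.mul_sum, ← Finset.sum_sub_distrib, ← Finset.sum_add_distrib]
  exact Finset.sum_congr rfl fun j _ => by ring

/-- Equivalence of the front propagation Model 1(ii) update formula and the
ℓ² graph-eikonal equation at node i. -/
theorem stmt1 {ι : Type*} [Fintype ι] [Nonempty ι]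
    (w u : ι → ℝ) (ui s : ℝ) (hw : ∀ j, 0 < w j) (hs : 0 < s)
    (K : Finset ι) (hK : K = Finset.univ.filter fun j => u j < ui)
    (z μ σsq : ℝ)
    (hz : z = ∑ j ∈ K, (w j) ^ 2)
    (hμ : μ = (∑ j ∈ K, (w j) ^ 2 * u j) / z)
    (hσ : σsq = (∑ j ∈ K, (w j) ^ 2 * (u j) ^ 2) / z - μ ^ 2) :
    (K.Nonempty ∧ σsq ≤ s ^ 2 / z ∧ ui = μ + Real.sqrt (s ^ 2 / z - σsq)) ↔
      ∑ j, (w j) ^ 2 * (max (ui - u j) 0) ^ 2 = s ^ 2 := by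
  rw [sum_mul_sq_max_sub_zero (fun j => w j ^ 2), ← hK]
  rcases K.eq_empty_or_nonempty with hE | hne
  · subst hE
    simp [(pow_pos hs 2).ne]
  have hzpos : 0 < z := hz ▸ Finset.sum_pos (fun j _ => pow_pos (hw j) 2) hne
  have hA : ∑ j ∈ K, (w j) ^ 2 * u j = z * μ := by
    rw [hμ, mul_div_cancel₀ _ hzpos.ne']
  have hB : ∑ j ∈ K, (w j) ^ 2 * (u j) ^ 2 = z * (σsq + μ ^ 2) := by
    rw [hσ, sub_add_cancel, mul_div_cancel₀ _ hzpos.ne']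
  have hμle : μ ≤ ui := by
    rw [hμ, div_le_iff₀ hzpos, hz, Finset.mul_sum]
    refine Finset.sum_le_sum fun j hj => ?_
    rw [hK, Finset.mem_filter] at hj
    rw [mul_comm]
    exact mul_le_mul_of_nonneg_right hj.2.le (sq_nonneg _)
  have key : ∑ j ∈ K, (w j) ^ 2 * (ui - u j) ^ 2 = s ^ 2 ↔ (ui - μ) ^ 2 = s ^ 2 / z - σsq := by
    rw [sum_mul_sub_sq K (fun j => w j ^ 2), hA, hB, ← hz, eq_sub_iff_add_eq,
      eq_div_iff hzpos.ne']
    constructor <;> intro h <;> linarith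
  rw [key]
  constructor
  · rintro ⟨-, hle, hui⟩
    rw [sub_eq_of_eq_add' hui, Real.sq_sqrt (sub_nonneg.2 hle)]
  · intro h
    refine ⟨hne, sub_nonneg.1 (h ▸ sq_nonneg _), ?_⟩
    rw [← h, Real.sqrt_sq (sub_nonneg.2 hμle)]
    ring
end

section
/- Let i be a node with nonempty finite neighbour set N, weights w : N → ℝ with w j > 0 for all j ∈ N, slowness s > 0, value u_i ∈ ℝ and neighbour values u : N → ℝ, and let K = {j ∈ N : u j < u_i}. Set y = ∑_{j ∈ K} w j. Then the following are equivalent: (a) K is nonempty and u_i = (s + ∑_{j ∈ K} w j · u j) / y; (b) ∑_{j ∈ N} w j · (u_i − u j)⁺ = s. (Equivalence of the front propagation Model 1(iii) update formula and the ℓ¹ graph-eikonal equation at node i.) -/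
/-- Equivalence of the front propagation Model 1(iii) update formula and the
ℓ¹ graph-eikonal equation at node i. -/
theorem stmt2 {ι : Type*} [Fintype ι] [Nonempty ι]
    (w u : ι → ℝ) (ui s : ℝ) (hw : ∀ j, 0 < w j) (hs : 0 < s)
    (K : Finset ι) (hK : K = Finset.univ.filter fun j => u j < ui)
    (y : ℝ) (hy : y = ∑ j ∈ K, w j) :
    (K.Nonempty ∧ ui = (s + ∑ j ∈ K, w j * u j) / y) ↔
      ∑ j, w j * max (ui - u j) 0 = s := by
  have hsum : ∑ j, w j * max (ui - u j) 0 = ui * y - ∑ j ∈ K, w j * u j := by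
    rw [hy, Finset.mul_sum, ← Finset.sum_sub_distrib, hK, Finset.sum_filter]
    refine Finset.sum_congr rfl fun j _ => ?_
    split_ifs with h
    · rw [max_eq_left (sub_pos.2 h).le]
      ring
    · rw [max_eq_right (sub_nonpos.2 (not_lt.1 h)), mul_zero]
  rw [hsum]
  rcases K.eq_empty_or_nonempty with hempty | hne
  · simp [hempty, hy, hs.ne]
  · have hypos : 0 < y := hy ▸ Finset.sum_pos (fun j _ => hw j) hne
    simp only [hne, true_and]
    rw [eq_div_iff hypos.ne', sub_eq_iff_eq_add]
end

section
/- Let i be a node with nonempty finite neighbour set N, weights w : N → ℝ with w j > 0 for all j ∈ N, slowness s > 0, value u_i ∈ ℝ and neighbour values u : N → ℝ. Then u_i = min over all nonempty subsets K ⊆ N of (s + ∑_{j ∈ K} w j · u j) / (∑_{j ∈ K} w j) if and only if ∑_{j ∈ N} w j · (u_i − u j)⁺ = s. (Core of the equivalence between the first arrival time Model 2(iii) over path sets and the ℓ¹ graph-eikonal equation.) -/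
theorem sum_mul_sub_eq {ι : Type*} (K : Finset ι) (w u : ι → ℝ) (a : ℝ) :
    ∑ j ∈ K, w j * (a - u j) = a * ∑ j ∈ K, w j - ∑ j ∈ K, w j * u j := by
  simp only [mul_sub, Finset.sum_sub_distrib, mul_comm a, Finset.sum_mul]

theorem sum_mul_sub_le_sum_mul_max {ι : Type*} [Fintype ι] (K : Finset ι) (w u : ι → ℝ) (a : ℝ)
    (hw : ∀ j, 0 ≤ w j) :
    ∑ j ∈ K, w j * (a - u j) ≤ ∑ j, w j * max (a - u j) 0 :=
  (Finset.sum_le_sum fun j _ => mul_le_mul_of_nonneg_left (le_max_left _ _) (hw j)).trans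
    (Finset.sum_le_sum_of_subset_of_nonneg (Finset.subset_univ K)
      fun j _ _ => mul_nonneg (hw j) (le_max_right _ _))

theorem sum_mul_max_eq_sum_filter {ι : Type*} [Fintype ι] (w u : ι → ℝ) (a : ℝ) :
    ∑ j, w j * max (a - u j) 0 = ∑ j with u j < a, w j * (a - u j) := by
  rw [Finset.sum_filter]
  refine Finset.sum_congr rfl fun j _ => ?_
  split_ifs with h
  · rw [max_eq_left (by linarith)]
  · rw [max_eq_right (by linarith), mul_zero]

/-- Core of the equivalence between the first arrival time Model 2(iii) over path
sets and the ℓ¹ graph-eikonal equation: `ui` is the minimum over all nonempty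
subsets `K ⊆ N` of `(s + ∑ j ∈ K, w j * u j) / (∑ j ∈ K, w j)` iff
`∑ j, w j * (ui - u j)⁺ = s`. -/
theorem stmt4 {ι : Type*} [Fintype ι] [Nonempty ι]
    (w u : ι → ℝ) (ui s : ℝ) (hw : ∀ j, 0 < w j) (hs : 0 < s) :
    IsLeast {t : ℝ | ∃ K : Finset ι, K.Nonempty ∧
        t = (s + ∑ j ∈ K, w j * u j) / (∑ j ∈ K, w j)} ui ↔
      ∑ j, w j * max (ui - u j) 0 = s := by
  have hpos : ∀ K : Finset ι, K.Nonempty → 0 < ∑ j ∈ K, w j :=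
    fun K hK => Finset.sum_pos (fun j _ => hw j) hK
  have hle : ∀ K : Finset ι, K.Nonempty →
      (ui ≤ (s + ∑ j ∈ K, w j * u j) / (∑ j ∈ K, w j) ↔ ∑ j ∈ K, w j * (ui - u j) ≤ s) := by
    intro K hK
    rw [le_div_iff₀ (hpos K hK), sum_mul_sub_eq, sub_le_iff_le_add]
  have heq : ∀ K : Finset ι, K.Nonempty →
      (ui = (s + ∑ j ∈ K, w j * u j) / (∑ j ∈ K, w j) ↔ ∑ j ∈ K, w j * (ui - u j) = s) := by
    intro K hK
    rw [eq_div_iff (hpos K hK).ne', sum_mul_sub_eq, sub_eq_iff_eq_add]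
  have hub := fun K : Finset ι => sum_mul_sub_le_sum_mul_max K w u ui fun j => (hw j).le
  constructor
  · rintro ⟨⟨K, hK, hKeq⟩, hmin⟩
    refine le_antisymm ?_ (((heq K hK).1 hKeq).symm.le.trans (hub K))
    rw [sum_mul_max_eq_sum_filter]
    rcases (Finset.univ.filter fun j => u j < ui).eq_empty_or_nonempty with hP | hP
    · simpa [hP] using hs.le
    · exact (hle _ hP).1 (hmin ⟨_, hP, rfl⟩)
  · intro h
    refine ⟨⟨Finset.univ.filter fun j => u j < ui, ?_, ?_⟩, ?_⟩
    · rw [sum_mul_max_eq_sum_filter] at h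
      exact Finset.nonempty_of_sum_ne_zero (h.trans_ne hs.ne')
    · rw [sum_mul_max_eq_sum_filter] at h
      exact (heq _ (Finset.nonempty_of_sum_ne_zero (h.trans_ne hs.ne'))).2 h
    · rintro t ⟨K, hK, rfl⟩
      exact (hle K hK).2 ((hub K).trans h.le)
end

section
/- Let V be a finite set of vertices, w : V → V → ℝ with w j i ≥ 0 (an edge (j,i) exists iff w j i > 0, and N(i) = {j : w j i > 0}), let ∂V ⊆ V be nonempty with ∂V ≠ V, and let s : V → ℝ satisfy s i > 0 for all i. A path from x to y is a finite sequence of pairwise distinct vertices (x = i₁, …, i_M = y) with w i_{m−1} i_m > 0 for m = 2, …, M, and its travel time is ∑_{m=2}^{M} s i_m / (w i_{m−1} i_m). Assume every vertex i ∉ ∂V is joined to some vertex of ∂V by a path. Define u : V → ℝ by u i = 0 for i ∈ ∂V and, for i ∉ ∂V, u i = the minimum over all x₀ ∈ ∂V and all paths p from x₀ to i of the travel time of p. Then for every i ∉ ∂V: max_{j ∈ N(i)} w j i · (u i − u j)⁺ = s i. (The first arrival time over paths—equivalently Dijkstra's algorithm and Model 2(i)—solves the ℓ∞ graph-eikonal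 equation.) -/
open scoped Classical

/-- The travel time of a path `(i₁, …, i_M)`, namely `∑_{m=2}^M s i_m / w i_{m-1} i_m`. -/
noncomputable def travelTime {V : Type*} (s : V → ℝ) (w : V → V → ℝ) : List V → ℝ
  | [] => 0
  | [_] => 0
  | a :: b :: rest => s b / w a b + travelTime s w (b :: rest)

/-- `p` is a path from `x` to `y`: a finite sequence of pairwise distinct vertices
starting at `x`, ending at `y`, with consecutive vertices joined by edges of
positive weight. -/
def IsPath {V : Type*} (w : V → V → ℝ) (x y : V) (p : List V) : Prop :=
  p.Nodup ∧ p.head? = some x ∧ p.getLast? = some y ∧ p.Chain' (fun a b => 0 < w a b)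

theorem travelTime_append_cons {V : Type*} (s : V → ℝ) (w : V → V → ℝ) (p : List V) (j : V)
    (r : List V) :
    travelTime s w (p ++ j :: r) = travelTime s w (p ++ [j]) + travelTime s w (j :: r) := by
  induction p with
  | nil => simp [travelTime]
  | cons a p ih =>
    cases p with
    | nil => simp [travelTime]
    | cons b p =>
      simp only [List.cons_append, travelTime] at ih ⊢
      rw [ih, add_assoc]

theorem travelTime_nonneg {V : Type*} {s : V → ℝ} {w : V → V → ℝ} (hs : ∀ i, 0 ≤ s i)
    (hw : ∀ j i, 0 ≤ w j i) (p : List V) : 0 ≤ travelTime s w p := by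
  induction p with
  | nil => simp [travelTime]
  | cons a p ih =>
    cases p with
    | nil => simp [travelTime]
    | cons b p => exact add_nonneg (div_nonneg (hs b) (hw a b)) ih

namespace IsPath

variable {V : Type*} {w : V → V → ℝ} {x y z : V} {p q : List V}

theorem singleton (w : V → V → ℝ) (x : V) : IsPath w x x [x] :=
  ⟨List.nodup_singleton x, rfl, rfl, List.isChain_singleton x⟩

theorem eq_concat (h : IsPath w x y p) : ∃ q, p = q ++ [y] := by
  obtain ⟨-, -, hy, -⟩ := h
  exact ⟨p.dropLast, (List.dropLast_append_getLast? y hy).symm⟩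

theorem append_left (h : IsPath w x y (p ++ z :: q)) : IsPath w x z (p ++ [z]) := by
  obtain ⟨hnd, hx, -, hc⟩ := h
  refine ⟨?_, ?_, by simp, (List.isChain_split.1 hc).1⟩
  · exact hnd.sublist (by simp)
  · cases p <;> simpa using hx

theorem concat (h : IsPath w x y p) (hz : z ∉ p) (hyz : 0 < w y z) :
    IsPath w x z (p ++ [z]) := by
  obtain ⟨q, rfl⟩ := h.eq_concat
  obtain ⟨hnd, hx, -, hc⟩ := h
  refine ⟨?_, ?_, by simp, ?_⟩
  · exact List.nodup_append.2 ⟨hnd, by simp, by grind⟩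
  · rw [List.head?_append, hx, Option.some_or]
  · rw [List.append_assoc]
    exact List.isChain_split.2 ⟨hc, by simpa using hyz⟩

end IsPath

/-- The first arrival time over paths from the boundary (Dijkstra / Model 2(i))
solves the ℓ∞ graph-eikonal equation. -/
theorem stmt5 {V : Type*} [Fintype V]
    (w : V → V → ℝ) (hw : ∀ j i, 0 ≤ w j i)
    (B : Finset V) (hB : B.Nonempty) (hBV : B ≠ Finset.univ)
    (s : V → ℝ) (hs : ∀ i, 0 < s i)
    (hconn : ∀ i ∉ B, ∃ x0 ∈ B, ∃ p : List V, IsPath w x0 i p)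
    (u : V → ℝ)
    (hu0 : ∀ i ∈ B, u i = 0)
    (humin : ∀ i ∉ B, IsLeast
      {t : ℝ | ∃ x0 ∈ B, ∃ p : List V, IsPath w x0 i p ∧ t = travelTime s w p} (u i)) :
    ∀ i ∉ B, ∃ hne : (Finset.univ.filter fun j => 0 < w j i).Nonempty,
      (Finset.univ.filter fun j => 0 < w j i).sup' hne
        (fun j => w j i * max (u i - u j) 0) = s i := by
  have exists_path : ∀ j, ∃ x0 ∈ B, ∃ p, IsPath w x0 j p ∧ u j = travelTime s w p := by
    intro j
    by_cases hj : j ∈ B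
    · exact ⟨j, hj, [j], IsPath.singleton w j, hu0 j hj⟩
    · exact (humin j hj).1
  have u_le : ∀ j, ∀ x0 ∈ B, ∀ p, IsPath w x0 j p → u j ≤ travelTime s w p := by
    intro j x0 hx0 p hp
    by_cases hj : j ∈ B
    · exact (hu0 j hj).trans_le (travelTime_nonneg (fun i => (hs i).le) hw p)
    · exact (humin j hj).2 ⟨x0, hx0, p, hp, rfl⟩
  intro i hi
  have upper : ∀ j, 0 < w j i → u i ≤ u j + s i / w j i := by
    intro j hj
    obtain ⟨x0, hx0, p, hp, hu⟩ := exists_path j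
    by_cases hip : i ∈ p
    · obtain ⟨q, r, rfl⟩ := List.append_of_mem hip
      have h := u_le i x0 hx0 _ hp.append_left
      rw [travelTime_append_cons] at hu
      have hr := travelTime_nonneg (fun i => (hs i).le) hw (i :: r)
      have hd := div_nonneg (hs i).le (hw j i)
      linarith
    · have h := u_le i x0 hx0 _ (hp.concat hip hj)
      obtain ⟨q, rfl⟩ := hp.eq_concat
      rw [List.append_assoc, List.singleton_append, travelTime_append_cons, ← hu] at h
      simpa [travelTime] using h
  have attained : ∃ j, 0 < w j i ∧ u j + s i / w j i ≤ u i := by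
    obtain ⟨x0, hx0, p, hp, hu⟩ := exists_path i
    obtain ⟨q, rfl⟩ := hp.eq_concat
    rcases List.eq_nil_or_concat q with rfl | ⟨r, j, rfl⟩
    · have h : i = x0 := by simpa using hp.2.1
      exact absurd (h ▸ hx0) hi
    · rw [List.concat_eq_append, List.append_assoc, List.singleton_append] at hp hu
      have hj : 0 < w j i := by simpa using (List.isChain_split.1 hp.2.2.2).2
      have h := u_le j x0 hx0 _ hp.append_left
      rw [travelTime_append_cons] at hu
      simp only [travelTime, add_zero] at hu
      exact ⟨j, hj, by linarith⟩
  obtain ⟨j, hj, hle⟩ := attained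
  have hmem : j ∈ Finset.univ.filter fun j => 0 < w j i := by simpa using hj
  refine ⟨⟨j, hmem⟩, le_antisymm (Finset.sup'_le _ _ fun k hk => ?_) ?_⟩
  · have hk : 0 < w k i := by simpa using hk
    rw [mul_comm, ← le_div_iff₀ hk]
    exact max_le (by linarith [upper k hk]) (div_pos (hs i) hk).le
  · refine le_trans ?_ (Finset.le_sup' (fun j => w j i * max (u i - u j) 0) hmem)
    rw [mul_comm, ← div_le_iff₀ hj]
    exact le_max_of_le_left (by linarith)
end

section
/- Let κ be an even natural number with κ ≥ 4, let φ ∈ ℝ, and for j = 1, …, κ let ζ_j = (cos(φ + 2πj/κ), sin(φ + 2πj/κ)) ∈ ℝ². Then for every v ∈ ℝ²: ∑_{j=1}^{κ} ((⟨v, ζ_j⟩)⁺)² = (κ/4) · ‖v‖², where ‖v‖ is the Euclidean norm. (The positive-part ℓ² eikonal sum over all κ directions of a rotated regular κ-neighbour grid reduces to (κ/4)·‖v‖², so the formal p = 2 limit equation is independent of the grid.) -/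
open scoped RealInnerProductSpace

theorem sum_exp_equidistributed_eq_zero {m : ℕ} (hm : 2 ≤ m) (a : ℝ) :
    ∑ i ∈ Finset.range m, Complex.exp (((a + 2 * Real.pi * i / m : ℝ) : ℂ) * Complex.I) = 0 := by
  have h := (Complex.isPrimitiveRoot_exp m (by lia)).geom_sum_eq_zero (by lia)
  calc
    _ = ∑ i ∈ Finset.range m, Complex.exp (a * Complex.I) *
          Complex.exp (2 * Real.pi * Complex.I / m) ^ i := by
      refine Finset.sum_congr rfl fun i _ => ?_
      rw [← Complex.exp_nat_mul, ← Complex.exp_add]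
      congr 1
      push_cast
      ring
    _ = 0 := by rw [← Finset.mul_sum, h, mul_zero]

theorem sum_cos_equidistributed_eq_zero {m : ℕ} (hm : 2 ≤ m) (a : ℝ) :
    ∑ i ∈ Finset.range m, Real.cos (a + 2 * Real.pi * i / m) = 0 := by
  have h := congrArg Complex.re (sum_exp_equidistributed_eq_zero hm a)
  simpa only [Complex.re_sum, Complex.exp_ofReal_mul_I_re, Complex.zero_re] using h

theorem sum_sin_equidistributed_eq_zero {m : ℕ} (hm : 2 ≤ m) (a : ℝ) :
    ∑ i ∈ Finset.range m, Real.sin (a + 2 * Real.pi * i / m) = 0 := by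
  have h := congrArg Complex.im (sum_exp_equidistributed_eq_zero hm a)
  simpa only [Complex.im_sum, Complex.exp_ofReal_mul_I_im, Complex.zero_im] using h

theorem max_zero_sq_add_max_neg_zero_sq (a : ℝ) : max a 0 ^ 2 + max (-a) 0 ^ 2 = a ^ 2 := by
  rcases le_total a 0 with h | h
  · rw [max_eq_right h, max_eq_left (neg_nonneg.mpr h)]
    ring
  · rw [max_eq_left h, max_eq_right (neg_nonpos.mpr h)]
    ring

theorem sq_mul_cos_add_mul_sin (x y t : ℝ) :
    (x * Real.cos t + y * Real.sin t) ^ 2 =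
      (x ^ 2 + y ^ 2) / 2 + (x ^ 2 - y ^ 2) / 2 * Real.cos (2 * t) +
        x * y * Real.sin (2 * t) := by
  rw [Real.cos_two_mul, Real.sin_two_mul]
  linear_combination y ^ 2 * Real.sin_sq_add_cos_sq t

/-- The positive-part ℓ² eikonal sum over all κ directions of a rotated regular
κ-neighbour grid reduces to (κ/4)·‖v‖², so the formal p = 2 limit equation is
independent of the grid. -/
theorem stmt9 (κ : ℕ) (hκ : Even κ) (h4 : 4 ≤ κ) (φ : ℝ)
    (ζ : ℕ → EuclideanSpace ℝ (Fin 2))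
    (hζ : ∀ j : ℕ, ζ j = (WithLp.equiv 2 (Fin 2 → ℝ)).symm
      ![Real.cos (φ + 2 * Real.pi * j / κ), Real.sin (φ + 2 * Real.pi * j / κ)])
    (v : EuclideanSpace ℝ (Fin 2)) :
    ∑ j ∈ Finset.Icc 1 κ, (max ⟪v, ζ j⟫ 0) ^ 2 = κ / 4 * ‖v‖ ^ 2 := by
  obtain ⟨m, rfl⟩ := hκ
  have hm : 2 ≤ m := by lia
  have hm0 : (m : ℝ) ≠ 0 := by
    exact_mod_cast (by lia : m ≠ 0)
  have inner_eq (j : ℕ) : ⟪v, ζ j⟫ = v 0 * Real.cos (φ + 2 * Real.pi * j / (m + m : ℕ)) +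
      v 1 * Real.sin (φ + 2 * Real.pi * j / (m + m : ℕ)) := by
    rw [hζ]
    simp [PiLp.inner_apply, Fin.sum_univ_two, mul_comm]
  have inner_antipodal (j : ℕ) : ⟪v, ζ (m + j)⟫ = -⟪v, ζ j⟫ := by
    have angle : φ + 2 * Real.pi * (m + j : ℕ) / (m + m : ℕ) =
        φ + 2 * Real.pi * j / (m + m : ℕ) + Real.pi := by
      push_cast
      field_simp
      ring
    rw [inner_eq, inner_eq, angle, Real.cos_add_pi, Real.sin_add_pi]
    ring
  have inner_sq (i : ℕ) : ⟪v, ζ (i + 1)⟫ ^ 2 = (v 0 ^ 2 + v 1 ^ 2) / 2 +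
      (v 0 ^ 2 - v 1 ^ 2) / 2 *
        Real.cos ((2 * φ + 2 * Real.pi / m) + 2 * Real.pi * i / m) +
      v 0 * v 1 * Real.sin ((2 * φ + 2 * Real.pi / m) + 2 * Real.pi * i / m) := by
    have angle : 2 * (φ + 2 * Real.pi * (i + 1 : ℕ) / (m + m : ℕ)) =
        (2 * φ + 2 * Real.pi / m) + 2 * Real.pi * i / m := by
      push_cast
      field_simp
      ring
    rw [inner_eq, sq_mul_cos_add_mul_sin, angle]
  have norm_sq : ‖v‖ ^ 2 = v 0 ^ 2 + v 1 ^ 2 := by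
    simp [EuclideanSpace.norm_sq_eq, Fin.sum_univ_two]
  calc
    _ = ∑ i ∈ Finset.range (m + m), max ⟪v, ζ (i + 1)⟫ 0 ^ 2 := by
      rw [Finset.range_eq_Ico, Finset.sum_Ico_add' (fun j => max ⟪v, ζ j⟫ 0 ^ 2)]
      rfl
    _ = ∑ i ∈ Finset.range m, ⟪v, ζ (i + 1)⟫ ^ 2 := by
      rw [Finset.sum_range_add, ← Finset.sum_add_distrib]
      refine Finset.sum_congr rfl fun i _ => ?_
      rw [add_assoc, inner_antipodal, max_zero_sq_add_max_neg_zero_sq]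
    _ = _ := by
      simp only [inner_sq, Finset.sum_add_distrib, ← Finset.mul_sum,
        sum_cos_equidistributed_eq_zero hm, sum_sin_equidistributed_eq_zero hm, norm_sq,
        Finset.sum_const, Finset.card_range, nsmul_eq_mul]
      push_cast
      ring
end

section
/- Let i be a node with nonempty finite neighbour set N, weights w : N → ℝ with w j > 0 for all j ∈ N, slowness s > 0, value u_i ∈ ℝ and neighbour values u : N → ℝ. If u satisfies the ℓ² graph-eikonal equation ∑_{j ∈ N} (w j)² · ((u_i − u j)⁺)² = s² and we set K = {j ∈ N : u j < u_i}, z = ∑_{j ∈ K} (w j)², μ = (1/z) ∑_{j ∈ K} (w j)² · u j and σ² = (1/z) ∑_{j ∈ K} (w j)² · (u j)² − μ², then K is nonempty, u_i > μ, the discriminant satisfies s²/z − σ² ≥ 0, and u_i is the larger root of the associated quadratic: u_i = μ + √(s²/z − σ²). (The value at node i is determined from its lower-valued neighbours by the larger root of the quadratic equation arising in the ℓ² fast marching update.) -/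
/-- The value at node i is determined from its lower-valued neighbours by the
larger root of the quadratic equation arising in the ℓ² fast marching update. -/
theorem stmt19 {ι : Type*} [Fintype ι] [Nonempty ι]
    (w u : ι → ℝ) (ui s : ℝ) (hw : ∀ j, 0 < w j) (hs : 0 < s)
    (heik : ∑ j, (w j) ^ 2 * (max (ui - u j) 0) ^ 2 = s ^ 2)
    (K : Finset ι) (hK : K = Finset.univ.filter fun j => u j < ui)
    (z μ σsq : ℝ)
    (hz : z = ∑ j ∈ K, (w j) ^ 2)
    (hμ : μ = (∑ j ∈ K, (w j) ^ 2 * u j) / z)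
    (hσ : σsq = (∑ j ∈ K, (w j) ^ 2 * (u j) ^ 2) / z - μ ^ 2) :
    K.Nonempty ∧ μ < ui ∧ 0 ≤ s ^ 2 / z - σsq ∧ ui = μ + Real.sqrt (s ^ 2 / z - σsq) := by
  have hsum : ∑ j ∈ K, (w j) ^ 2 * (ui - u j) ^ 2 = s ^ 2 := by
    rw [← heik, hK, Finset.sum_filter]
    refine Finset.sum_congr rfl fun j _ => ?_
    split_ifs with h
    · rw [max_eq_left (by linarith)]
    · rw [max_eq_right (by linarith)]
      simp
  have hne : K.Nonempty := by
    by_contra h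
    rw [Finset.not_nonempty_iff_eq_empty] at h
    rw [h, Finset.sum_empty] at hsum
    exact (pow_pos hs 2).ne hsum
  have hzpos : 0 < z := hz ▸ Finset.sum_pos (fun j _ => pow_pos (hw j) 2) hne
  have hlt : μ < ui := by
    rw [hμ, div_lt_iff₀ hzpos, hz, Finset.mul_sum]
    refine Finset.sum_lt_sum_of_nonempty hne fun j hj => ?_
    rw [mul_comm ui]
    have hj' : u j < ui := by simpa [hK] using hj
    exact mul_lt_mul_of_pos_left hj' (pow_pos (hw j) 2)
  have hexpand : s ^ 2 = z * ui ^ 2 - 2 * ui * (∑ j ∈ K, (w j) ^ 2 * u j)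
      + ∑ j ∈ K, (w j) ^ 2 * (u j) ^ 2 := by
    rw [← hsum, hz, Finset.sum_mul, Finset.mul_sum, ← Finset.sum_sub_distrib,
      ← Finset.sum_add_distrib]
    exact Finset.sum_congr rfl fun j _ => by ring
  have hdisc : s ^ 2 / z - σsq = (ui - μ) ^ 2 := by
    rw [hσ, hexpand, hμ]
    field_simp
    ring
  refine ⟨hne, hlt, hdisc ▸ sq_nonneg _, ?_⟩
  rw [hdisc, Real.sqrt_sq (by linarith)]
  ring
end
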